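/- arXiv:2508.02114 — 8 statements merged into one kernel-verified Lean document; each statement's English description precedes it below -/
import Mathlib

section
/- Let A be an algebra with a right identity u (i.e., a·u = a for all a ∈ A), let B be any algebra, and let α : A → B be an algebra homomorphism. Then every Jordan left α-centralizer T : A → B is a left α-centralizer, i.e., T(a·x) = T(a)·α(x) for all a, x ∈ A. -/
/-- Let `A` be a (complex, non-unital) algebra with a right identity `u`,
`B` any algebra, and `α : A → B` an algebra homomorphism. Then every Jordan left
`α`-centralizer `T : A → B` (an additive map with `T (a * a) = T a * α a`) is a left
`α`-centralizer: `T (a * x) = T a * α x` for all `a x : A`. -/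
theorem jordan_left_centralizer_is_left_centralizer_of_right_identity
    {A B : Type*} [NonUnitalRing A] [NonUnitalRing B]
    [Module ℂ A] [IsScalarTower ℂ A A] [SMulCommClass ℂ A A]
    [Module ℂ B] [IsScalarTower ℂ B B] [SMulCommClass ℂ B B]
    (u : A) (hu : ∀ a : A, a * u = a)
    (α : A →ₙₐ[ℂ] B) (T : A →+ B)
    (hT : ∀ a : A, T (a * a) = T a * α a) :
    ∀ a x : A, T (a * x) = T a * α x := by
  -- Polarization of the Jordan identity.
  have hJ : ∀ a x : A, T (a * x) + T (x * a) = T a * α x + T x * α a := by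
    intro a x
    have h := hT (a + x)
    simp only [mul_add, add_mul, map_add, hT] at h
    have key : T (a * x) + T (x * a) - (T a * α x + T x * α a) = 0 := by
      rw [← sub_eq_zero] at h
      rw [← h]
      abel
    exact sub_eq_zero.mp key
  have hJu : ∀ a : A, T a + T (u * a) = T a * α u + T u * α a := by
    intro a
    simpa only [hu] using hJ a u
  have hαu : ∀ a : A, α a * α u = α a := fun a => by rw [← map_mul, hu]
  have hmulu : ∀ a : A, T (u * a) * α u = T u * α a := by
    intro a
    have h := congrArg (· * α u) (hJu a)
    simpa only [add_mul, mul_assoc, hαu, add_right_inj] using h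
  have hTu : ∀ a : A, T (u * a) = T u * α a := by
    intro a
    have h := hJu (u * a)
    have hTu_self : T u * α u = T u := by rw [← hT u, hu]
    rw [← mul_assoc, hu, hmulu, map_mul α, ← mul_assoc, hTu_self, ← two_nsmul, ← two_nsmul] at h
    have h2 : (2 : ℂ) • T (u * a) = (2 : ℂ) • (T u * α a) := by
      simpa only [two_smul] using h
    exact smul_right_injective B (two_ne_zero (α := ℂ)) h2
  have hTe : ∀ a : A, T a * α u = T a := by
    intro a
    have h := hJu a
    rw [hTu] at h
    exact (add_right_cancel h).symm
  intro a x
  -- The complement `a - u * a` of `u * a` is annihilated by left multiplication.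
  have hn : ∀ y : A, y * (a - u * a) = 0 := by
    intro y
    rw [mul_sub, ← mul_assoc, hu, sub_self]
  have hαn : T x * α (a - u * a) = 0 := by
    rw [← hTe x, mul_assoc, ← map_mul, hn, map_zero, mul_zero]
  have h := hJ (a - u * a) x
  rw [hn, hαn, map_zero, add_zero, add_zero, sub_mul, map_sub, map_sub, sub_mul, mul_assoc,
    hTu, hTu, map_mul α, ← mul_assoc] at h
  exact sub_left_injective h
end

section
/- Let A and B be algebras over a field of characteristic different from 2 (e.g., ℂ), α : A → B an algebra homomorphism, and T : A → B a linear Jordan left α-centralizer. Then T(a·x·a) = T(a)·α(x)·α(a) for all a, x ∈ A. -/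
/-- Let `A`, `B` be algebras over a field `K` of characteristic different
from 2, `α : A → B` an algebra homomorphism, and `T : A → B` a linear Jordan left
`α`-centralizer (`T (a * a) = T a * α a`). Then `T (a * x * a) = T a * α x * α a`
for all `a x : A`. -/
theorem jordan_left_centralizer_triple_identity
    {K : Type*} [Field K] (hchar : (2 : K) ≠ 0)
    {A B : Type*} [NonUnitalRing A] [NonUnitalRing B]
    [Module K A] [IsScalarTower K A A] [SMulCommClass K A A]
    [Module K B] [IsScalarTower K B B] [SMulCommClass K B B]
    (α : A →ₙₐ[K] B) (T : A →ₗ[K] B)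
    (hT : ∀ a : A, T (a * a) = T a * α a) :
    ∀ a x : A, T (a * x * a) = T a * α x * α a := by
  have polarized : ∀ a b : A, T (a * b) + T (b * a) = T a * α b + T b * α a := by
    intro a b
    have h := hT (a + b)
    simp only [add_mul, mul_add, map_add, hT] at h
    rw [← sub_eq_zero] at h ⊢
    rw [← h]
    abel
  intro a x
  have h₁ := polarized a (a * x + x * a)
  have h₂ := polarized (a * a) x
  have h₃ := polarized a x
  have h₄ : T (a * (a * x + x * a)) + T ((a * x + x * a) * a)
      = (T (a * a * x) + T (x * (a * a))) + (T (a * x * a) + T (a * x * a)) := by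
    simp only [mul_add, add_mul, map_add, mul_assoc]
    abel
  rw [h₄, h₂, hT, map_add T, h₃] at h₁
  have h₅ : (2 : K) • T (a * x * a) = (2 : K) • (T a * α x * α a) := by
    rw [two_smul, two_smul]
    simp only [map_add, map_mul, mul_add, add_mul, mul_assoc] at h₁ ⊢
    rw [← sub_eq_zero] at h₁ ⊢
    rw [← h₁]
    abel
  exact smul_right_injective B hchar h₅
end

section
/- Let A be an algebra with a right identity u (i.e., a·u = a for all a ∈ A), B an algebra, α : A → B an algebra homomorphism, and T : A → B a Jordan left α-centralizer. Then T(u·x) = T(u)·α(x) for all x ∈ A. -/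
/-- The polarized form of the identity defining a Jordan left centralizer. -/
theorem map_mul_add_mul_of_map_mul_self {A B : Type*} [NonUnitalRing A] [NonUnitalRing B]
    (α T : A →+ B) (hT : ∀ a : A, T (a * a) = T a * α a) (a b : A) :
    T (a * b) + T (b * a) = T a * α b + T b * α a := by
  have h := hT (a + b)
  simp only [mul_add, add_mul, map_add, hT] at h
  have h' : T a * α a + T b * α b + (T (a * b) + T (b * a)) =
      T a * α a + T b * α b + (T a * α b + T b * α a) := by
    convert h using 1 <;> abel
  exact add_left_cancel h'

/-- Let `A` be a (complex, non-unital) algebra with a right identity `u`,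
`B` an algebra, `α : A → B` an algebra homomorphism, and `T : A → B` a Jordan left
`α`-centralizer (an additive map with `T (a * a) = T a * α a`). Then
`T (u * x) = T u * α x` for all `x : A`. -/
theorem jordan_left_centralizer_right_identity_apply
    {A B : Type*} [NonUnitalRing A] [NonUnitalRing B]
    [Module ℂ A] [IsScalarTower ℂ A A] [SMulCommClass ℂ A A]
    [Module ℂ B] [IsScalarTower ℂ B B] [SMulCommClass ℂ B B]
    (u : A) (hu : ∀ a : A, a * u = a)
    (α : A →ₙₐ[ℂ] B) (T : A →+ B)
    (hT : ∀ a : A, T (a * a) = T a * α a) :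
    ∀ x : A, T (u * x) = T u * α x := by
  intro x
  have huu : u * (u * x) = u * x := by rw [← mul_assoc, hu]
  have hTu : T u * α u = T u := by rw [← hT, hu]
  have hpol (a : A) : T a + T (u * a) = T a * α u + T u * α a := by
    have h := map_mul_add_mul_of_map_mul_self (α : A →+ B) T hT a u
    rwa [hu] at h
  have hright : T (u * x) * α u = T u * α x := by
    have h := congrArg (· * α u) (hpol x)
    simp only [add_mul, mul_assoc, ← map_mul, hu] at h
    exact add_left_cancel h
  have htwo := hpol (u * x)
  rw [huu, hright, map_mul α, ← mul_assoc, hTu] at htwo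
  have : (2 : ℂ) • T (u * x) = (2 : ℂ) • (T u * α x) := by
    rw [two_smul, two_smul, htwo]
  exact smul_right_injective B (two_ne_zero : (2 : ℂ) ≠ 0) this
end

section
/- Let A be an algebra with a right identity u, B an algebra, α : A → B an algebra homomorphism, and T : A → B a Jordan left α-centralizer. If r ∈ A satisfies a·r = 0 for all a ∈ A, then T(r·x) = T(r)·α(x) for all x ∈ A. -/
/-- Linearization of the Jordan left centralizer identity. -/
theorem jordan_left_centralizer_map_mul_add_mul
    {A B : Type*} [NonUnitalRing A] [NonUnitalRing B] (α : A →ₙ+* B) (T : A →+ B)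
    (hT : ∀ a : A, T (a * a) = T a * α a) (a b : A) :
    T (a * b + b * a) = T a * α b + T b * α a := by
  have h := hT (a + b)
  simp only [add_mul, mul_add, map_add, hT] at h ⊢
  rw [← sub_eq_zero] at h ⊢
  rw [← h]
  abel

/-- A Jordan left centralizer on an algebra with a right identity annihilates the image of the
right annihilator. -/
theorem jordan_left_centralizer_mul_map_annihilator
    {A B : Type*} [NonUnitalRing A] [NonUnitalRing B] [IsAddTorsionFree B]
    (u : A) (hu : ∀ a : A, a * u = a) (α : A →ₙ+* B) (T : A →+ B)
    (hT : ∀ a : A, T (a * a) = T a * α a)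
    (r : A) (hr : ∀ a : A, a * r = 0) (x : A) : T x * α r = 0 := by
  have hα (a : A) : α a * α r = 0 := by rw [← map_mul, hr, map_zero]
  have key (y : A) : T (u * y) * α r + T y * α r = 0 := by
    have h := jordan_left_centralizer_map_mul_add_mul α T hT u y
    rw [hu, map_add] at h
    rw [← add_mul, h, add_mul, mul_assoc, mul_assoc, hα, hα, mul_zero, mul_zero, add_zero]
  have hux : T (u * x) * α r = 0 := by
    have h := key (u * x)
    rw [← mul_assoc, hu] at h
    exact self_eq_neg.mp (eq_neg_of_add_eq_zero_left h)
  simpa [hux] using key x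

/-- Let `A` be a (complex, non-unital) algebra with a right identity `u`,
`B` an algebra, `α : A → B` an algebra homomorphism, and `T : A → B` a Jordan left
`α`-centralizer. If `r : A` satisfies `a * r = 0` for all `a : A`, then
`T (r * x) = T r * α x` for all `x : A`. -/
theorem jordan_left_centralizer_annihilator_apply
    {A B : Type*} [NonUnitalRing A] [NonUnitalRing B]
    [Module ℂ A] [IsScalarTower ℂ A A] [SMulCommClass ℂ A A]
    [Module ℂ B] [IsScalarTower ℂ B B] [SMulCommClass ℂ B B]
    (u : A) (hu : ∀ a : A, a * u = a)
    (α : A →ₙₐ[ℂ] B) (T : A →+ B)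
    (hT : ∀ a : A, T (a * a) = T a * α a)
    (r : A) (hr : ∀ a : A, a * r = 0) :
    ∀ x : A, T (r * x) = T r * α x := by
  intro x
  have : IsAddTorsionFree B := .of_isTorsionFree ℂ B
  have h := jordan_left_centralizer_map_mul_add_mul (α : A →ₙ+* B) T hT r x
  have h0 := jordan_left_centralizer_mul_map_annihilator u hu (α : A →ₙ+* B) T hT r hr x
  rw [hr, add_zero, h0, add_zero] at h
  exact h
end

section
/- Let A be a unital algebra with identity 1_A, B any algebra, α : A → B an algebra homomorphism, and T : A → B a Jordan left α-centralizer. Then T(a) = T(1_A)·α(a) for all a ∈ A; in particular T coincides with the canonical left α-centralizer Λ_{T(1_A), α}. -/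
/-- Let `A` be a unital complex algebra with identity `1`, `B` any
(non-unital) algebra, `α : A → B` an algebra homomorphism, and `T : A → B` a Jordan
left `α`-centralizer (an additive map with `T (a * a) = T a * α a`). Then
`T a = T 1 * α a` for all `a : A`; that is, `T` coincides with the canonical left
`α`-centralizer `Λ_{T 1, α} : a ↦ T 1 * α a`. -/
theorem jordan_left_centralizer_eq_canonical_of_unital
    {A B : Type*} [Ring A] [Algebra ℂ A]
    [NonUnitalRing B] [Module ℂ B] [IsScalarTower ℂ B B] [SMulCommClass ℂ B B]
    (α : A →ₙₐ[ℂ] B) (T : A →+ B)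
    (hT : ∀ a : A, T (a * a) = T a * α a) :
    ∀ a : A, T a = T 1 * α a := by
  intro a
  have polarized : T a + T a = T a * α 1 + T 1 * α a := by
    have h := hT (a + 1)
    have h1 := hT 1
    simp only [mul_one] at h1
    simp only [add_mul, mul_add, mul_one, one_mul, map_add, hT a, ← h1] at h
    have : T a + T a - (T a * α 1 + T 1 * α a) = 0 := by
      rw [← sub_eq_zero] at h
      rw [← h]
      abel
    exact sub_eq_zero.mp this
  have mul_map_one : T a * α 1 = T 1 * α a := by
    have h := congrArg (· * α 1) polarized
    simp only [add_mul, mul_assoc, ← map_mul, mul_one] at h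
    exact add_left_cancel h
  rw [mul_map_one, ← two_smul ℂ, ← two_smul ℂ (T 1 * α a)] at polarized
  exact smul_right_injective B (two_ne_zero : (2 : ℂ) ≠ 0) polarized
end

section
/- Let A be a unital normed algebra, B any normed algebra, and α : A → B a continuous algebra homomorphism. Then every linear Jordan left α-centralizer T : A → B is continuous; indeed ‖T(a)‖ ≤ ‖T(1_A)‖·‖α‖·‖a‖ for all a ∈ A. -/
/-- A Jordan left `α`-centralizer on a unital algebra is left multiplication of `α` by `T 1`. -/
theorem jordan_left_centralizer_apply
    {A B : Type*} [Ring A] [Module ℂ A] [NonUnitalRing B] [Module ℂ B]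
    (α : A →ₗ[ℂ] B) (hα : ∀ a x : A, α (a * x) = α a * α x)
    (T : A →ₗ[ℂ] B) (hT : ∀ a : A, T (a * a) = T a * α a) (a : A) :
    T a = T 1 * α a := by
  have two : T a + T a = T a * α 1 + T 1 * α a := by
    have h := hT (a + 1)
    have h1 := hT 1
    simp only [add_mul, mul_add, mul_one, one_mul, map_add, hT a] at h h1
    rw [← h1] at h
    have h' : T a * α a + T 1 + (T a + T a) = T a * α a + T 1 + (T a * α 1 + T 1 * α a) := by
      convert h using 1 <;> abel
    exact add_left_cancel h'
  have key : T a * α 1 = T 1 * α a := by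
    have h := congrArg (· * α 1) two
    simp only [add_mul, mul_assoc, ← hα, mul_one] at h
    exact add_left_cancel h
  rw [key, ← two_smul ℂ, ← two_smul ℂ] at two
  exact smul_right_injective B (two_ne_zero : (2 : ℂ) ≠ 0) two

/-- Let `A` be a unital normed algebra, `B` any normed algebra, and
`α : A → B` a continuous algebra homomorphism. Then every linear Jordan left
`α`-centralizer `T : A → B` is continuous; indeed `‖T a‖ ≤ ‖T 1‖ * ‖α‖ * ‖a‖` for all `a`. -/
theorem jordan_left_centralizer_continuous_of_unital
    {A B : Type*} [NormedRing A] [NormedAlgebra ℂ A]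
    [NonUnitalNormedRing B] [NormedSpace ℂ B] [IsScalarTower ℂ B B] [SMulCommClass ℂ B B]
    (α : A →L[ℂ] B) (hα : ∀ a x : A, α (a * x) = α a * α x)
    (T : A →ₗ[ℂ] B)
    (hT : ∀ a : A, T (a * a) = T a * α a) :
    Continuous T ∧ ∀ a : A, ‖T a‖ ≤ ‖T 1‖ * ‖α‖ * ‖a‖ := by
  have bound : ∀ a : A, ‖T a‖ ≤ ‖T 1‖ * ‖α‖ * ‖a‖ := fun a => by
    rw [jordan_left_centralizer_apply α.toLinearMap hα T hT a, mul_assoc]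
    exact (norm_mul_le _ _).trans
      (mul_le_mul_of_nonneg_left (α.le_opNorm a) (norm_nonneg _))
  exact ⟨AddMonoidHomClass.continuous_of_bound T _ bound, bound⟩
end

section
/- Let A be a Banach algebra with a bounded (two-sided) approximate identity, B any Banach algebra, α : A → B an algebra homomorphism, and T : A → B a continuous linear Jordan left α-centralizer. If T is weakly compact, then there exists b₀ ∈ B such that T(a) = b₀·α(a) for all a ∈ A. -/
open Filter Topology

/-- A map between normed spaces is *weakly compact* if the image of the closed unit ball
is relatively compact in the weak topology. -/
def IsWeaklyCompactMap {E F : Type*} [NormedAddCommGroup E] [NormedSpace ℂ E]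
    [NormedAddCommGroup F] [NormedSpace ℂ F] (f : E → F) : Prop :=
  IsCompact (closure (toWeakSpace ℂ F '' (f '' Metric.closedBall 0 1)))

/-- A bounded filter is mapped by a weakly compact linear map to a filter with a weak cluster
point, which is realised as a weak limit along an ultrafilter. -/
theorem IsWeaklyCompactMap.exists_tendsto {E F : Type*} [NormedAddCommGroup E] [NormedSpace ℂ E]
    [NormedAddCommGroup F] [NormedSpace ℂ F] {T : E →L[ℂ] F} (hT : IsWeaklyCompactMap T)
    (l : Filter E) [l.NeBot] (hl : ∃ C : ℝ, ∀ᶠ e in l, ‖e‖ ≤ C) :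
    ∃ U : Ultrafilter E, ↑U ≤ l ∧ ∃ b : F,
      Tendsto (fun e => toWeakSpace ℂ F (T e)) U (𝓝 (toWeakSpace ℂ F b)) := by
  obtain ⟨C, hC⟩ := hl
  set U := Ultrafilter.of l
  have hU : (U : Filter E) ≤ l := Ultrafilter.of_le l
  obtain ⟨D, hDC, hD⟩ : ∃ D : ℝ, C ≤ D ∧ 0 < D := ⟨max C 1, le_max_left _ _, by positivity⟩
  have hD' : (D : ℂ) ≠ 0 := by exact_mod_cast hD.ne'
  have hmem : ∀ᶠ e in (U : Filter E), toWeakSpace ℂ F (T ((D : ℂ)⁻¹ • e)) ∈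
      closure (toWeakSpace ℂ F '' (T '' Metric.closedBall 0 1)) := by
    filter_upwards [hU hC] with e he
    refine subset_closure ⟨_, ⟨_, ?_, rfl⟩, rfl⟩
    rw [mem_closedBall_zero_iff, norm_smul, norm_inv, Complex.norm_real, Real.norm_of_nonneg hD.le,
      inv_mul_le_iff₀ hD, mul_one]
    exact he.trans hDC
  obtain ⟨x, -, hx⟩ := isCompact_iff_ultrafilter_le_nhds'.1 hT
    (U.map fun e => toWeakSpace ℂ F (T ((D : ℂ)⁻¹ • e))) hmem
  obtain ⟨y, rfl⟩ := (toWeakSpace ℂ F).surjective x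
  refine ⟨U, hU, (D : ℂ) • y, ?_⟩
  have hx' : Tendsto (fun e => toWeakSpace ℂ F (T ((D : ℂ)⁻¹ • e))) U (𝓝 (toWeakSpace ℂ F y)) := hx
  simpa only [← map_smul, smul_smul, mul_inv_cancel₀ hD', one_smul] using hx'.const_smul (D : ℂ)

theorem apply_tendsto_of_tendsto_toWeakSpace {ι F : Type*} [NormedAddCommGroup F] [NormedSpace ℂ F]
    {l : Filter ι} {u : ι → F} {b : F}
    (h : Tendsto (fun i => toWeakSpace ℂ F (u i)) l (𝓝 (toWeakSpace ℂ F b))) (f : F →L[ℂ] ℂ) :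
    Tendsto (fun i => f (u i)) l (𝓝 (f b)) :=
  ((WeakBilin.eval_continuous (topDualPairing ℂ F).flip f).tendsto _).comp h

/-- The range of a linear map has the same weak and norm closures. -/
theorem mem_closure_range_of_tendsto_toWeakSpace {ι E F : Type*}
    [NormedAddCommGroup E] [NormedSpace ℂ E] [NormedAddCommGroup F] [NormedSpace ℂ F]
    {l : Filter ι} [l.NeBot] (T : E →L[ℂ] F) {u : ι → E} {b : F}
    (h : Tendsto (fun i => toWeakSpace ℂ F (T (u i))) l (𝓝 (toWeakSpace ℂ F b))) :
    b ∈ closure (Set.range T) := by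
  have hconv : Convex ℝ (Set.range T) :=
    ((LinearMap.range (T : E →ₗ[ℂ] F)).restrictScalars ℝ).convex
  have hb : toWeakSpace ℂ F b ∈ closure (toWeakSpace ℂ F '' Set.range T) :=
    mem_closure_of_tendsto h (.of_forall fun i => ⟨_, ⟨u i, rfl⟩, rfl⟩)
  rw [← hconv.toWeakSpace_closure ℂ] at hb
  simpa using hb

/-- A continuous additive map that vanishes on squares of an algebra with an approximate identity is
zero. -/
theorem eq_zero_of_forall_mul_self {A B : Type*} [NonUnitalNormedRing A]
    [NormedAddCommGroup B] [NormedSpace ℂ B] {l : Filter A} [l.NeBot]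
    (hlai : ∀ a : A, Tendsto (fun e : A => e * a) l (𝓝 a))
    (hrai : ∀ a : A, Tendsto (fun e : A => a * e) l (𝓝 a))
    {S : A →+ B} (hS : Continuous S) (h : ∀ a, S (a * a) = 0) (a : A) : S a = 0 := by
  have hjordan : ∀ e, S (e * a + a * e) = 0 := fun e => by
    simpa [add_mul, mul_add, h, add_comm] using h (e + a)
  have hlim := (hS.tendsto _).comp ((hlai a).add (hrai a))
  have hzero : S (a + a) = 0 :=
    tendsto_nhds_unique hlim (tendsto_const_nhds.congr fun e => (hjordan e).symm)
  rw [map_add, ← two_smul ℂ] at hzero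
  exact (smul_eq_zero.1 hzero).resolve_left two_ne_zero

section JordanCentralizer

variable {A B : Type*}
    [NonUnitalNormedRing A] [NormedSpace ℂ A] [NonUnitalNormedRing B] [NormedSpace ℂ B]
    {α : A →ₙₐ[ℂ] B} {T : A →L[ℂ] B}

theorem jordan_left_centralizer_mul_add_mul (hT : ∀ a : A, T (a * a) = T a * α a) (a b : A) :
    T (a * b + b * a) = T a * α b + T b * α a := by
  have h := hT (a + b)
  simp only [add_mul, mul_add, map_add, hT] at h ⊢
  rw [← sub_eq_zero] at h ⊢
  rw [← h]
  abel

theorem jordan_left_centralizer_mul_mul (hT : ∀ a : A, T (a * a) = T a * α a) (a b : A) :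
    T (a * b * a) = T a * α b * α a := by
  have h₁ := jordan_left_centralizer_mul_add_mul hT a (a * b + b * a)
  have h₂ := jordan_left_centralizer_mul_add_mul hT (a * a) b
  rw [jordan_left_centralizer_mul_add_mul hT a b, map_add α, map_mul α, map_mul α] at h₁
  rw [map_mul α, hT] at h₂
  have h₃ : a * (a * b + b * a) + (a * b + b * a) * a =
      (a * a * b + b * (a * a)) + (2 : ℂ) • (a * b * a) := by
    rw [two_smul]; noncomm_ring
  rw [h₃, map_add, h₂, map_smul] at h₁
  have h₄ : (2 : ℂ) • T (a * b * a) = (2 : ℂ) • (T a * α b * α a) := by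
    rw [← add_right_inj, h₁, two_smul]; noncomm_ring
  exact smul_right_injective B (two_ne_zero (α := ℂ)) h₄

variable [IsScalarTower ℂ B B] [SMulCommClass ℂ B B]

/-- Each map `a ↦ T c * α a` is continuous, although `α` itself need not be, and hence so is
`a ↦ b * α a` for every `b` in the closure of the range of `T`. -/
theorem continuous_mul_of_mem_closure_range
    [IsScalarTower ℂ A A] [SMulCommClass ℂ A A] [CompleteSpace A]
    (hT : ∀ a : A, T (a * a) = T a * α a) {b : B} (hb : b ∈ closure (Set.range T)) :
    Continuous fun a => b * α a := by
  obtain ⟨x, hx, hxb⟩ := mem_closure_iff_seq_limit.1 hb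
  choose c hc using hx
  let L : ℕ → A →L[ℂ] B := fun n =>
    T ∘L (ContinuousLinearMap.mul ℂ A (c n) + (ContinuousLinearMap.mul ℂ A).flip (c n)) -
      (ContinuousLinearMap.mul ℂ B).flip (α (c n)) ∘L T
  have hL : ∀ n a, L n a = x n * α a := fun n a => by
    have := jordan_left_centralizer_mul_add_mul hT (c n) a
    simp [L] at this ⊢
    rw [this, ← hc]
    abel
  have hlim : Tendsto (fun n a => L n a) atTop (𝓝 fun a => b * α a) :=
    tendsto_pi_nhds.2 fun a => by
      simpa only [hL] using hxb.mul_const (α a)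
  exact (continuousLinearMapOfTendsto L hlim).continuous

/-- On squares, a Jordan left centralizer is given by the weak limit of its values along an
approximate identity. -/
theorem jordan_left_centralizer_mul_self_of_tendsto {l : Filter A} [l.NeBot]
    (hlai : ∀ a : A, Tendsto (fun e : A => e * a) l (𝓝 a))
    (hrai : ∀ a : A, Tendsto (fun e : A => a * e) l (𝓝 a))
    (hT : ∀ a : A, T (a * a) = T a * α a) {b : B}
    (hb : Tendsto (fun e => toWeakSpace ℂ B (T e)) l (𝓝 (toWeakSpace ℂ B b))) (a : A) :
    T (a * a) = b * α (a * a) := by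
  let R := (ContinuousLinearMap.mul ℂ B).flip (α a)
  have hR : ∀ y, R y = y * α a := fun _ => rfl
  refine (SeparatingDual.eq_iff_forall_dual_eq (R := ℂ)).2 fun f => ?_
  have h₁ : Tendsto (fun e => f (R (T (e * a + a * e))) - f (R (R (T e)))) l
      (𝓝 (f (R (T (a + a))) - f (R (R b)))) :=
    ((f.continuous.comp (R.continuous.comp T.continuous)).tendsto _ |>.comp
      ((hlai a).add (hrai a))).sub
      (apply_tendsto_of_tendsto_toWeakSpace hb (f ∘L R ∘L R))
  have h₂ : Tendsto (fun e => f (T (a * e * a))) l (𝓝 (f (T (a * a)))) :=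
    (f.continuous.comp T.continuous).tendsto _ |>.comp ((hrai a).mul_const a)
  have h₃ : ∀ e, f (T (a * e * a)) = f (R (T (e * a + a * e))) - f (R (R (T e))) := fun e => by
    rw [← map_sub, jordan_left_centralizer_mul_add_mul hT, jordan_left_centralizer_mul_mul hT]
    simp only [hR]
    congr 1
    noncomm_ring
  have h₄ := tendsto_nhds_unique h₂ (h₁.congr fun e => (h₃ e).symm)
  simp only [hR, map_add, add_mul, ← hT, mul_assoc, ← map_mul] at h₄
  linear_combination -h₄

end JordanCentralizer

/-- Let `A` be a Banach algebra with a bounded two-sided approximate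
identity, `B` any Banach algebra, `α : A → B` an algebra homomorphism, and `T : A → B` a
continuous linear Jordan left `α`-centralizer. If `T` is weakly compact, then there is
`b₀ ∈ B` with `T a = b₀ * α a` for all `a : A`. -/
theorem weakly_compact_jordan_left_centralizer_canonical
    {A B : Type*}
    [NonUnitalNormedRing A] [NormedSpace ℂ A] [IsScalarTower ℂ A A] [SMulCommClass ℂ A A]
    [CompleteSpace A]
    [NonUnitalNormedRing B] [NormedSpace ℂ B] [IsScalarTower ℂ B B] [SMulCommClass ℂ B B]
    [CompleteSpace B]
    (l : Filter A) [l.NeBot]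
    (hbdd : ∃ C : ℝ, ∀ᶠ e in l, ‖e‖ ≤ C)
    (hlai : ∀ a : A, Tendsto (fun e : A => e * a) l (𝓝 a))
    (hrai : ∀ a : A, Tendsto (fun e : A => a * e) l (𝓝 a))
    (α : A →ₙₐ[ℂ] B)
    (T : A →L[ℂ] B)
    (hT : ∀ a : A, T (a * a) = T a * α a)
    (hTwc : IsWeaklyCompactMap T) :
    ∃ b₀ : B, ∀ a : A, T a = b₀ * α a := by
  obtain ⟨U, hU, b, hb⟩ := hTwc.exists_tendsto l hbdd
  have hl : ∀ a : A, Tendsto (fun e : A => e * a) U (𝓝 a) := fun a => (hlai a).mono_left hU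
  have hr : ∀ a : A, Tendsto (fun e : A => a * e) U (𝓝 a) := fun a => (hrai a).mono_left hU
  have hcont := continuous_mul_of_mem_closure_range hT
    (mem_closure_range_of_tendsto_toWeakSpace T hb)
  let S : A →+ B := (T : A →+ B) - (AddMonoidHom.mulLeft b).comp (α : A →+ B)
  have hS : ∀ a, S a = T a - b * α a := fun _ => rfl
  refine ⟨b, fun a => sub_eq_zero.1 ((hS a).symm.trans ?_)⟩
  refine eq_zero_of_forall_mul_self hl hr (T.continuous.sub hcont) (fun a => ?_) a
  rw [hS, jordan_left_centralizer_mul_self_of_tendsto hl hr hT hb, sub_self]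
end

section
/- Let A be a Banach algebra with a bounded (two-sided) approximate identity, B any Banach algebra, α : A → B an algebra homomorphism, and T : A → B a continuous linear Jordan left α-centralizer. If α is weakly compact and T is surjective, then there exists a₀ ∈ A such that α(a) = T(a₀·a) for all a ∈ A. -/
open Filter Topology

namespace IsWeaklyCompactMap

variable {E F : Type*} [NormedAddCommGroup E] [NormedSpace ℂ E]
  [NormedAddCommGroup F] [NormedSpace ℂ F]

/-- A weakly compact linear map is bounded on the unit ball, hence continuous. -/
theorem continuous {f : E →ₗ[ℂ] F} (hf : IsWeaklyCompactMap f) : Continuous f := by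
  have hpt : ∀ φ : StrongDual ℂ F, ∃ C, ∀ a : Metric.closedBall (0 : E) 1,
      ‖NormedSpace.inclusionInDoubleDual ℂ F (f a) φ‖ ≤ C := by
    intro φ
    have hφ : Continuous fun x : WeakSpace ℂ F => φ ((toWeakSpace ℂ F).symm x) :=
      WeakBilin.eval_continuous (topDualPairing ℂ F).flip φ
    obtain ⟨C, hC⟩ := hf.exists_bound_of_continuousOn hφ.continuousOn
    refine ⟨C, fun a => ?_⟩
    simpa using hC _ (subset_closure ⟨_, ⟨a, a.2, rfl⟩, rfl⟩)
  obtain ⟨C, hC⟩ := banach_steinhaus hpt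
  obtain ⟨K, hK⟩ := LinearMap.bound_of_ball_bound one_pos C f fun z hz => by
    rw [← (NormedSpace.inclusionInDoubleDualLi ℂ (E := F)).norm_map (f z)]
    exact hC ⟨z, Metric.ball_subset_closedBall hz⟩
  exact (f.mkContinuous K hK).continuous

/-- A weakly compact linear map sends a bounded ultrafilter to a weakly convergent one. -/
theorem exists_weak_limit {f : E →ₗ[ℂ] F} (hf : IsWeaklyCompactMap f) (u : Ultrafilter E)
    {C : ℝ} (hC : ∀ᶠ e in (u : Filter E), ‖e‖ ≤ C) :
    ∃ y : F, ∀ φ : StrongDual ℂ F, Tendsto (fun e => φ (f e)) u (𝓝 (φ y)) := by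
  obtain ⟨D, hD, hCD⟩ : ∃ D : ℝ, 0 < D ∧ C ≤ D :=
    ⟨max C 1, lt_max_of_lt_right one_pos, le_max_left _ _⟩
  let g : E → WeakSpace ℂ F := fun e => toWeakSpace ℂ F (f ((D : ℂ)⁻¹ • e))
  obtain ⟨y, -, hy⟩ := hf.ultrafilter_le_nhds (u.map g) (by
    rw [le_principal_iff]
    change ∀ᶠ e in (u : Filter E), g e ∈ _
    filter_upwards [hC] with e he
    refine subset_closure ⟨_, ⟨_, ?_, rfl⟩, rfl⟩
    rw [mem_closedBall_zero_iff, norm_smul, norm_inv, Complex.norm_real, Real.norm_of_nonneg hD.le,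
      inv_mul_le_iff₀ hD, mul_one]
    exact he.trans hCD)
  refine ⟨(D : ℂ) • (toWeakSpace ℂ F).symm y, fun φ => ?_⟩
  have hφ : Continuous fun x : WeakSpace ℂ F => φ ((toWeakSpace ℂ F).symm x) :=
    WeakBilin.eval_continuous (topDualPairing ℂ F).flip φ
  have hlim : Tendsto (fun e => φ ((toWeakSpace ℂ F).symm (g e))) u
      (𝓝 (φ ((toWeakSpace ℂ F).symm y))) := (hφ.tendsto y).comp hy
  have hD' : (D : ℂ) ≠ 0 := by exact_mod_cast hD.ne'
  simpa [g, hD'] using hlim.const_mul (D : ℂ)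

end IsWeaklyCompactMap

section JordanLeftCentralizer

variable {R S : Type*} [NonUnitalRing R] [Module ℂ R] [NonUnitalRing S] [Module ℂ S]
  {α : R →ₙₐ[ℂ] S} {T : R →ₗ[ℂ] S}

theorem jordanLeftCentralizer_map_mul_add_mul (hT : ∀ a, T (a * a) = T a * α a) (a b : R) :
    T (a * b + b * a) = T a * α b + T b * α a := by
  have h := hT (a + b)
  simp only [mul_add, add_mul, map_add, hT] at h ⊢
  grind

theorem jordanLeftCentralizer_map_mul_mul (hT : ∀ a, T (a * a) = T a * α a) (a b : R) :
    T (a * b * a) = T a * α (b * a) := by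
  have h1 := jordanLeftCentralizer_map_mul_add_mul hT a (a * b + b * a)
  have h2 := jordanLeftCentralizer_map_mul_add_mul hT (a * a) b
  rw [jordanLeftCentralizer_map_mul_add_mul hT a b] at h1
  simp only [mul_add, add_mul, map_add, map_mul, hT, mul_assoc] at h1 h2 ⊢
  have h3 : (2 : ℂ) • T (a * (b * a)) = (2 : ℂ) • (T a * (α b * α a)) := by
    simp only [two_smul]
    grind
  exact smul_right_injective S (two_ne_zero (α := ℂ)) h3

theorem jordanLeftCentralizer_map_mul_mul_add (hT : ∀ a, T (a * a) = T a * α a) (a b c : R) :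
    T (a * b * c + c * b * a) = T a * α (b * c) + T c * α (b * a) := by
  have h := jordanLeftCentralizer_map_mul_mul hT (a + c) b
  have ha := jordanLeftCentralizer_map_mul_mul hT a b
  have hc := jordanLeftCentralizer_map_mul_mul hT c b
  simp only [mul_add, add_mul, map_add] at h ha hc ⊢
  grind

end JordanLeftCentralizer

/-- Let `A` be a Banach algebra with a bounded two-sided approximate
identity, `B` any Banach algebra, `α : A → B` an algebra homomorphism, and `T : A → B` a
continuous linear Jordan left `α`-centralizer. If `α` is weakly compact and `T` is
surjective, then there is `a₀ ∈ A` with `α a = T (a₀ * a)` for all `a : A`. -/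
theorem alpha_factors_through_surjective_jordan_left_centralizer
    {A B : Type*}
    [NonUnitalNormedRing A] [NormedSpace ℂ A] [IsScalarTower ℂ A A] [SMulCommClass ℂ A A]
    [CompleteSpace A]
    [NonUnitalNormedRing B] [NormedSpace ℂ B] [IsScalarTower ℂ B B] [SMulCommClass ℂ B B]
    [CompleteSpace B]
    (l : Filter A) [l.NeBot]
    (hbdd : ∃ C : ℝ, ∀ᶠ e in l, ‖e‖ ≤ C)
    (hlai : ∀ a : A, Tendsto (fun e : A => e * a) l (𝓝 a))
    (hrai : ∀ a : A, Tendsto (fun e : A => a * e) l (𝓝 a))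
    (α : A →ₙₐ[ℂ] B)
    (T : A →L[ℂ] B)
    (hT : ∀ a : A, T (a * a) = T a * α a)
    (hαwc : IsWeaklyCompactMap (⇑α))
    (hTsurj : Function.Surjective T) :
    ∃ a₀ : A, ∀ a : A, α a = T (a₀ * a) := by
  obtain ⟨C, hC⟩ := hbdd
  have hα : Continuous α := IsWeaklyCompactMap.continuous (f := (α : A →ₗ[ℂ] B)) hαwc
  let u := Ultrafilter.of l
  have hu : (u : Filter A) ≤ l := Ultrafilter.of_le l
  obtain ⟨p, hp⟩ := IsWeaklyCompactMap.exists_weak_limit (f := (α : A →ₗ[ℂ] B)) hαwc u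
    (hC.filter_mono hu)
  replace hp : ∀ φ : StrongDual ℂ B, Tendsto (fun e => φ (α e)) u (𝓝 (φ p)) := hp
  have hlα (a : A) : Tendsto (fun e => α e * α a) u (𝓝 (α a)) := by
    simpa only [map_mul, Function.comp_def] using (hα.tendsto a).comp ((hlai a).mono_left hu)
  have hrα (a : A) : Tendsto (fun e => α a * α e) u (𝓝 (α a)) := by
    simpa only [map_mul, Function.comp_def] using (hα.tendsto a).comp ((hrai a).mono_left hu)
  have right_limit {x y : B} (h : Tendsto (fun e => x * α e) u (𝓝 y)) : x * p = y := by
    refine (SeparatingDual.eq_iff_forall_dual_eq (R := ℂ)).2 fun φ => ?_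
    exact tendsto_nhds_unique (hp (φ.comp (ContinuousLinearMap.mul ℂ B x)))
      ((φ.continuous.tendsto y).comp h)
  have left_limit {x y : B} (h : Tendsto (fun e => α e * x) u (𝓝 y)) : p * x = y := by
    refine (SeparatingDual.eq_iff_forall_dual_eq (R := ℂ)).2 fun φ => ?_
    exact tendsto_nhds_unique (hp (φ.comp ((ContinuousLinearMap.mul ℂ B).flip x)))
      ((φ.continuous.tendsto y).comp h)
  have hpα (a : A) : p * α a = α a := left_limit (hlα a)
  have hαp (a : A) : α a * p = α a := right_limit (hrα a)
  have hpp : p * p = p := by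
    refine (SeparatingDual.eq_iff_forall_dual_eq (R := ℂ)).2 fun φ => ?_
    refine tendsto_nhds_unique (hp (φ.comp ((ContinuousLinearMap.mul ℂ B).flip p))) ?_
    simpa [hαp] using hp φ
  have hT' : ∀ a, (T : A →ₗ[ℂ] B) (a * a) = (T : A →ₗ[ℂ] B) a * α a := hT
  have hmul (a b : A) : T (a * b) = T a * α b := by
    have hTe : Tendsto (fun e => T e * α (a * b)) u (𝓝 (T a * α b)) := by
      have h1 : Tendsto (fun e => T (b * a * e + e * a * b)) u (𝓝 (T (b * a + a * b))) := by
        refine (T.continuous.tendsto _).comp (((hrai (b * a)).mono_left hu).add ?_)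
        simpa only [mul_assoc] using (hlai (a * b)).mono_left hu
      have h2 := h1.sub ((hrα a).const_mul (T b))
      have h3 : T (b * a + a * b) - T b * α a = T a * α b := by
        rw [sub_eq_iff_eq_add']
        exact jordanLeftCentralizer_map_mul_add_mul hT' b a
      rw [h3] at h2
      refine h2.congr fun e => ?_
      rw [sub_eq_iff_eq_add', ← map_mul]
      exact jordanLeftCentralizer_map_mul_mul_add hT' b a e
    have hTα : Tendsto (fun e => T (a * b) * α e) u
        (𝓝 (T (a * b + a * b) - T a * α b)) := by
      have h1 : Tendsto (fun e => T (a * b * e + e * (a * b))) u (𝓝 (T (a * b + a * b))) :=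
        (T.continuous.tendsto _).comp
          (((hrai (a * b)).mono_left hu).add ((hlai (a * b)).mono_left hu))
      refine (h1.sub hTe).congr fun e => ?_
      rw [sub_eq_iff_eq_add]
      exact jordanLeftCentralizer_map_mul_add_mul hT' (a * b) e
    have h1 := right_limit hTα
    have h2 := congrArg (· * p) h1
    simp only [sub_mul, add_mul, map_add, mul_assoc, hpp, hαp] at h1 h2
    have h3 : (2 : ℂ) • T (a * b) = (2 : ℂ) • (T a * α b) := by
      simp only [two_smul]
      grind
    exact smul_right_injective B (two_ne_zero (α := ℂ)) h3
  obtain ⟨a₀, ha₀⟩ := hTsurj p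
  exact ⟨a₀, fun a => by rw [hmul, ha₀, hpα]⟩
end
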